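/- arXiv:2107.12820 — 3 statements merged into one kernel-verified Lean document; each statement's English description precedes it below -/
import Mathlib

section
/- There exists a constant C > 0, depending only on N, δ and max_j |a_j|, such that for every i ∈ {1,…,N} and every t ≥ 0 with the property that dist(supp ω_k(s,·), supp ω_j(s,·)) ≥ δ/2 for all k ≠ j and all s ∈ [0,t], one has (1/a_i) ∫_{ℝ²} |x − X_i(t)|² ω_i(t,x) dx ≤ e^{2Ct} ε². -/
open MeasureTheory
open scoped RealInnerProductSpace ENNReal Classical

/-- The two-dimensional Biot–Savart kernel `K(z) = (1/(2π)) z^⊥ / |z|²`, with `K(0) = 0`. -/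
noncomputable def biotSavart (z : EuclideanSpace ℝ (Fin 2)) : EuclideanSpace ℝ (Fin 2) :=
  if z = 0 then 0 else
    (1 / (2 * Real.pi * ‖z‖ ^ 2)) • (EuclideanSpace.equiv (Fin 2) ℝ).symm ![-(z 1), z 0]

section SoftSquare

variable {V : Type*} [NormedAddCommGroup V]

/-- The regularised radius `√(1 + κ|x|²)`. -/
noncomputable def softRadius (κ : ℝ) (x : V) : ℝ := √(1 + κ * ‖x‖ ^ 2)

/-- A smooth function with bounded gradient which increases to `|x|²` as `κ` decreases to zero. -/
noncomputable def softSq (κ : ℝ) (x : V) : ℝ := 2 * ‖x‖ ^ 2 / (1 + softRadius κ x)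

variable {κ : ℝ}

lemma softRadius_sq (hκ : 0 < κ) (x : V) : softRadius κ x ^ 2 = 1 + κ * ‖x‖ ^ 2 :=
  Real.sq_sqrt (by positivity)

lemma one_le_softRadius (hκ : 0 < κ) (x : V) : 1 ≤ softRadius κ x :=
  Real.one_le_sqrt.2 (by nlinarith [sq_nonneg ‖x‖])

lemma sqrt_mul_norm_le_softRadius (hκ : 0 < κ) (x : V) : √κ * ‖x‖ ≤ softRadius κ x := by
  refine Real.le_sqrt_of_sq_le ?_
  rw [mul_pow, Real.sq_sqrt hκ.le]
  linarith

lemma softSq_nonneg (hκ : 0 < κ) (x : V) : 0 ≤ softSq κ x := by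
  have := one_le_softRadius hκ x
  unfold softSq
  positivity

lemma softSq_le_norm_sq (hκ : 0 < κ) (x : V) : softSq κ x ≤ ‖x‖ ^ 2 := by
  have := one_le_softRadius hκ x
  unfold softSq
  rw [div_le_iff₀ (by linarith)]
  nlinarith [sq_nonneg ‖x‖]

lemma softSq_eq (hκ : 0 < κ) (x : V) : softSq κ x = 2 / κ * (softRadius κ x - 1) := by
  have h1 := one_le_softRadius hκ x
  have h2 := softRadius_sq hκ x
  unfold softSq
  have : 1 + softRadius κ x ≠ 0 := by linarith
  field_simp
  linarith

lemma norm_sq_div_softRadius_le (hκ : 0 < κ) (x : V) :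
    ‖x‖ ^ 2 / softRadius κ x ≤ softSq κ x := by
  have h1 := one_le_softRadius hκ x
  unfold softSq
  rw [div_le_div_iff₀ (by linarith) (by linarith)]
  nlinarith [sq_nonneg ‖x‖]

lemma abs_softRadius_inv_sub_le (hκ : 0 < κ) (x y : V) :
    |2 / softRadius κ x - 2 / softRadius κ y| ≤
      2 * κ * ‖x - y‖ * (‖x‖ + ‖y‖) /
        (softRadius κ x * softRadius κ y * (softRadius κ x + softRadius κ y)) := by
  have hx := one_le_softRadius hκ x
  have hy := one_le_softRadius hκ y
  have hx2 := softRadius_sq hκ x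
  have hy2 := softRadius_sq hκ y
  have key : 2 / softRadius κ x - 2 / softRadius κ y =
      2 * κ * ((‖y‖ - ‖x‖) * (‖x‖ + ‖y‖)) /
        (softRadius κ x * softRadius κ y * (softRadius κ x + softRadius κ y)) := by
    have : softRadius κ x + softRadius κ y ≠ 0 := by linarith
    field_simp
    linarith
  rw [key, abs_div, abs_of_pos (a := softRadius κ x * softRadius κ y * _) (by positivity),
    abs_mul, abs_of_pos (a := 2 * κ) (by positivity), abs_mul,
    abs_of_nonneg (a := ‖x‖ + ‖y‖) (by positivity), ← mul_assoc]
  gcongr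
  rw [abs_sub_comm]
  exact abs_norm_sub_norm_le x y

variable [InnerProductSpace ℝ V]

/-- The gradient of `softSq κ`. -/
noncomputable def softGrad (κ : ℝ) (x : V) : V := (2 / softRadius κ x) • x

lemma norm_softGrad (hκ : 0 < κ) (x : V) : ‖softGrad κ x‖ = 2 * ‖x‖ / softRadius κ x := by
  have h1 := one_le_softRadius hκ x
  unfold softGrad
  rw [norm_smul, Real.norm_of_nonneg (by positivity)]
  ring

lemma norm_softGrad_le (hκ : 0 < κ) (x : V) : ‖softGrad κ x‖ ≤ 2 / √κ := by
  have h1 := one_le_softRadius hκ x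
  have h2 := sqrt_mul_norm_le_softRadius hκ x
  have h3 := Real.sqrt_pos.2 hκ
  rw [norm_softGrad hκ, div_le_div_iff₀ (by linarith) h3]
  linarith

lemma norm_mul_norm_softGrad_le (hκ : 0 < κ) (x : V) :
    ‖x‖ * ‖softGrad κ x‖ ≤ 2 * softSq κ x := by
  have := norm_sq_div_softRadius_le hκ x
  rw [norm_softGrad hκ]
  calc _ = 2 * (‖x‖ ^ 2 / softRadius κ x) := by ring
    _ ≤ _ := by linarith

lemma norm_softGrad_sub_two_smul_le (hκ : 0 < κ) (hκ1 : κ ≤ 1) (x : V) :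
    ‖softGrad κ x - (2 : ℝ) • x‖ ≤ softSq κ x := by
  have h1 := one_le_softRadius hκ x
  have h2 := sqrt_mul_norm_le_softRadius hκ x
  have h3 := softSq_eq hκ x
  have h4 : softGrad κ x - (2 : ℝ) • x = (-(2 * (softRadius κ x - 1) / softRadius κ x)) • x := by
    unfold softGrad
    rw [← sub_smul]
    congr 1
    field_simp
    ring
  have h5 : 2 * (softRadius κ x - 1) = κ * softSq κ x := by
    rw [h3]; field_simp
  have h6 : κ * ‖x‖ ≤ softRadius κ x := by
    refine le_trans ?_ h2
    gcongr
    exact Real.le_sqrt_of_sq_le (by nlinarith)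
  have h7 := softSq_nonneg hκ x
  rw [h4, norm_smul, norm_neg, h5, Real.norm_of_nonneg (by positivity), div_mul_eq_mul_div,
    div_le_iff₀ (by linarith)]
  nlinarith

lemma softGrad_sub_softGrad (κ : ℝ) (x y : V) :
    softGrad κ x - softGrad κ y =
      (2 / softRadius κ x) • (x - y) + (2 / softRadius κ x - 2 / softRadius κ y) • y := by
  unfold softGrad
  module

lemma norm_softGrad_sub_le (hκ : 0 < κ) (x y : V) :
    ‖softGrad κ x - softGrad κ y‖ ≤ 4 * ‖x - y‖ := by
  have hx := one_le_softRadius hκ x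
  have hy := one_le_softRadius hκ y
  have hx2 := sqrt_mul_norm_le_softRadius hκ x
  have hy2 := sqrt_mul_norm_le_softRadius hκ y
  have hs := Real.mul_self_sqrt hκ.le
  have e1 : ‖(2 / softRadius κ x) • (x - y)‖ ≤ 2 * ‖x - y‖ := by
    rw [norm_smul, Real.norm_of_nonneg (by positivity)]
    gcongr
    rw [div_le_iff₀ (by linarith)]
    linarith
  have e2 : ‖(2 / softRadius κ x - 2 / softRadius κ y) • y‖ ≤ 2 * ‖x - y‖ := by
    rw [norm_smul, Real.norm_eq_abs]
    refine (mul_le_mul_of_nonneg_right (abs_softRadius_inv_sub_le hκ x y) (norm_nonneg _)).trans ?_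
    rw [div_mul_eq_mul_div, div_le_iff₀ (by positivity)]
    calc 2 * κ * ‖x - y‖ * (‖x‖ + ‖y‖) * ‖y‖
        = 2 * ‖x - y‖ * ((√κ * ‖y‖) * (√κ * ‖x‖ + √κ * ‖y‖)) := by
          linear_combination (-2 * ‖x - y‖ * (‖x‖ + ‖y‖) * ‖y‖) * hs
      _ ≤ 2 * ‖x - y‖ * (softRadius κ y * (softRadius κ x + softRadius κ y)) := by gcongr
      _ ≤ 2 * ‖x - y‖ * (softRadius κ x * softRadius κ y * (softRadius κ x + softRadius κ y)) := by
          gcongr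
          nlinarith
  rw [softGrad_sub_softGrad]
  linarith [norm_add_le ((2 / softRadius κ x) • (x - y))
    ((2 / softRadius κ x - 2 / softRadius κ y) • y)]

/-- A field orthogonal to `x - y` of size at most `1 / (2|x - y|)` only sees the failure of
`softSq κ` to be exactly quadratic. -/
lemma abs_inner_softGrad_sub_le (hκ : 0 < κ) (hκ1 : κ ≤ 1) (x y k : V)
    (hk : ⟪k, x - y⟫ = 0) (hk' : ‖k‖ * ‖x - y‖ ≤ 1 / 2) :
    |⟪k, softGrad κ x - softGrad κ y⟫| ≤ softSq κ x + softSq κ y := by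
  have hx := one_le_softRadius hκ x
  have hy := one_le_softRadius hκ y
  have hxs := norm_sq_div_softRadius_le hκ x
  have hys := norm_sq_div_softRadius_le hκ y
  set r := softRadius κ x
  set r' := softRadius κ y
  rw [softGrad_sub_softGrad, inner_add_right, inner_smul_right, hk, mul_zero, zero_add,
    inner_smul_right, abs_mul]
  have e1 : |⟪k, y⟫| ≤ ‖k‖ * ‖y‖ := abs_real_inner_le_norm k y
  have hd : 1 ≤ r * r' := by nlinarith
  have hq : ‖x‖ ^ 2 ≤ softSq κ x * r := (div_le_iff₀ (by linarith)).1 hxs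
  have hq' : ‖y‖ ^ 2 ≤ softSq κ y * r' := (div_le_iff₀ (by linarith)).1 hys
  have hp := softSq_nonneg hκ x
  have hp' := softSq_nonneg hκ y
  calc _ ≤ (2 * κ * ‖x - y‖ * (‖x‖ + ‖y‖) / (r * r' * (r + r'))) * (‖k‖ * ‖y‖) := by
        gcongr
        exact abs_softRadius_inv_sub_le hκ x y
    _ = (2 * κ * (‖x‖ + ‖y‖) * ‖y‖ * (‖k‖ * ‖x - y‖)) / (r * r' * (r + r')) := by ring
    _ ≤ (2 * 1 * (‖x‖ + ‖y‖) * ‖y‖ * (1 / 2)) / (r * r' * (r + r')) := by gcongr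
    _ ≤ softSq κ x + softSq κ y := by
        rw [div_le_iff₀ (by positivity)]
        have : (softSq κ x + softSq κ y) * (r + r') * 1
            ≤ (softSq κ x + softSq κ y) * (r + r') * (r * r') := by gcongr
        have h8 : softSq κ x * 1 ≤ softSq κ x * r' := by gcongr
        have h9 : softSq κ y * 1 ≤ softSq κ y * r := by gcongr
        have h10 : 0 ≤ softSq κ x * r := by positivity
        have h11 : 0 ≤ softSq κ y * r' := by positivity
        nlinarith [sq_nonneg (‖x‖ - ‖y‖), norm_nonneg x, norm_nonneg y]

lemma contDiff_softRadius (hκ : 0 < κ) : ContDiff ℝ 1 (softRadius κ : V → ℝ) := by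
  unfold softRadius
  refine ContDiff.sqrt (contDiff_const.add (contDiff_const.mul (contDiff_norm_sq ℝ))) fun x => ?_
  positivity

lemma contDiff_softSq (hκ : 0 < κ) : ContDiff ℝ 1 (softSq κ : V → ℝ) := by
  have h : (softSq κ : V → ℝ) = fun x => 2 / κ * (softRadius κ x - 1) := funext (softSq_eq hκ)
  have := contDiff_softRadius (V := V) hκ
  rw [h]
  fun_prop

lemma contDiff_softGrad (hκ : 0 < κ) : ContDiff ℝ 1 (softGrad κ : V → V) := by
  unfold softGrad
  refine ContDiff.smul (contDiff_const.div (contDiff_softRadius hκ) fun x => ?_) contDiff_id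
  linarith [one_le_softRadius hκ x]

lemma hasFDerivAt_softSq (hκ : 0 < κ) (x : V) :
    HasFDerivAt (softSq κ) (innerSL ℝ (softGrad κ x)) x := by
  have h : (softSq κ : V → ℝ) = fun x => 2 / κ * (softRadius κ x - 1) := funext (softSq_eq hκ)
  rw [h]
  have h1 : HasFDerivAt (fun x : V => 1 + κ * ‖x‖ ^ 2) (κ • (2 • innerSL ℝ x)) x :=
    (((hasStrictFDerivAt_norm_sq x).hasFDerivAt).const_mul κ).const_add 1
  have h2 := ((h1.sqrt (by positivity)).sub_const 1).const_mul (2 / κ)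
  refine h2.congr_fderiv ?_
  ext v
  have := one_le_softRadius hκ x
  simp only [softGrad, softRadius] at *
  simp
  field_simp

lemma abs_softSq_sub_le (hκ : 0 < κ) (x h : V) :
    |softSq κ (x + h) - softSq κ x - ⟪softGrad κ x, h⟫| ≤ 4 * ‖h‖ ^ 2 := by
  have key := (convex_closedBall x ‖h‖).norm_image_sub_le_of_norm_hasFDerivWithin_le'
    (f := softSq κ) (f' := fun z => innerSL ℝ (softGrad κ z)) (φ := innerSL ℝ (softGrad κ x))
    (C := 4 * ‖h‖) (x := x) (y := x + h)
    (fun z _ => (hasFDerivAt_softSq hκ z).hasFDerivWithinAt) (fun z hz => ?_)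
    (by simp) (by simp)
  · simpa [pow_two, mul_assoc] using key
  · rw [← map_sub, innerSL_apply_norm]
    refine (norm_softGrad_sub_le hκ z x).trans ?_
    gcongr
    simpa [dist_eq_norm] using hz

end SoftSquare

/-- The Euclidean plane. -/
abbrev Plane := EuclideanSpace ℝ (Fin 2)

section Kernel

/-- Rotation of the plane by a right angle. -/
noncomputable def perp (z : Plane) : Plane :=
  (EuclideanSpace.equiv (Fin 2) ℝ).symm ![-(z 1), z 0]

lemma perp_sub (z w : Plane) : perp (z - w) = perp z - perp w := by
  ext i
  fin_cases i
  · simp [perp]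
    ring
  · simp [perp]

lemma norm_perp (z : Plane) : ‖perp z‖ = ‖z‖ := by
  simp [EuclideanSpace.norm_eq, perp, Fin.sum_univ_two, add_comm]

lemma inner_perp_self (z : Plane) : ⟪perp z, z⟫ = 0 := by
  simp [perp, PiLp.inner_apply, Fin.sum_univ_two]
  ring

lemma perp_neg (z : Plane) : perp (-z) = -perp z := by
  ext i
  fin_cases i <;> simp [perp]

lemma continuous_perp : Continuous perp := by
  unfold perp
  fun_prop

lemma biotSavart_eq (z : Plane) : biotSavart z = (1 / (2 * Real.pi * ‖z‖ ^ 2)) • perp z := by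
  unfold biotSavart perp
  split_ifs with h
  · subst h; simp
  · rfl

lemma biotSavart_neg (z : Plane) : biotSavart (-z) = -biotSavart z := by
  simp [biotSavart_eq, perp_neg]

lemma inner_biotSavart_self (z : Plane) : ⟪biotSavart z, z⟫ = 0 := by
  rw [biotSavart_eq, inner_smul_left, inner_perp_self, mul_zero]

lemma norm_biotSavart (z : Plane) : ‖biotSavart z‖ = 1 / (2 * Real.pi) * ‖z‖⁻¹ := by
  rw [biotSavart_eq, norm_smul, norm_perp, Real.norm_of_nonneg (by positivity)]
  rcases eq_or_ne z 0 with rfl | h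
  · simp
  · have := norm_ne_zero_iff.2 h
    field_simp

lemma one_div_two_pi_le : 1 / (2 * Real.pi) ≤ 1 / 2 := by
  have := Real.pi_gt_three
  gcongr
  linarith

lemma norm_biotSavart_le (z : Plane) : ‖biotSavart z‖ ≤ ‖z‖⁻¹ := by
  rw [norm_biotSavart]
  have : 0 ≤ ‖z‖⁻¹ := by positivity
  nlinarith [one_div_two_pi_le]

lemma norm_biotSavart_mul_norm_le (z : Plane) : ‖biotSavart z‖ * ‖z‖ ≤ 1 / 2 := by
  rw [norm_biotSavart]
  rcases eq_or_ne z 0 with rfl | h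
  · simp
  · rw [mul_assoc, inv_mul_cancel₀ (norm_ne_zero_iff.2 h), mul_one]
    exact one_div_two_pi_le

lemma measurable_biotSavart : Measurable biotSavart := by
  have h : biotSavart = fun z => (1 / (2 * Real.pi * ‖z‖ ^ 2)) • perp z := funext biotSavart_eq
  rw [h]
  have := continuous_perp.measurable
  fun_prop

/-- The Biot–Savart kernel with its singularity removed inside the disc of radius `d`. -/
noncomputable def cutBiotSavart (d : ℝ) (z : Plane) : Plane :=
  (1 / (2 * Real.pi * max ‖z‖ d ^ 2)) • perp z

variable {d : ℝ}

lemma cutBiotSavart_eq {z : Plane} (hz : d ≤ ‖z‖) : cutBiotSavart d z = biotSavart z := by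
  rw [cutBiotSavart, biotSavart_eq, max_eq_left hz]

lemma norm_cutBiotSavart_le (hd : 0 < d) (z : Plane) : ‖cutBiotSavart d z‖ ≤ 1 / d := by
  have h1 : d ≤ max ‖z‖ d := le_max_right _ _
  have h2 : ‖z‖ ≤ max ‖z‖ d := le_max_left _ _
  have hpi := Real.pi_gt_three
  rw [cutBiotSavart, norm_smul, norm_perp, Real.norm_of_nonneg (by positivity)]
  set m := max ‖z‖ d
  rw [div_mul_eq_mul_div, div_le_div_iff₀ (by positivity) hd]
  have h3 : ‖z‖ * d ≤ m * m := by gcongr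
  have : 1 * m ^ 2 ≤ 2 * Real.pi * m ^ 2 := by
    gcongr
    linarith
  nlinarith

lemma norm_cutBiotSavart_sub_le (hd : 0 < d) (z w : Plane) :
    ‖cutBiotSavart d z - cutBiotSavart d w‖ ≤ 3 / d ^ 2 * ‖z - w‖ := by
  have hm1 : d ≤ max ‖z‖ d := le_max_right _ _
  have hm2 : d ≤ max ‖w‖ d := le_max_right _ _
  have hw : ‖w‖ ≤ max ‖w‖ d := le_max_left _ _
  have hmm : |max ‖w‖ d - max ‖z‖ d| ≤ ‖z - w‖ := by
    refine (abs_max_sub_max_le_abs _ _ _).trans ?_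
    rw [norm_sub_rev]
    exact abs_norm_sub_norm_le w z
  have hpi := Real.pi_gt_three
  have e : cutBiotSavart d z - cutBiotSavart d w = (1 / (2 * Real.pi)) •
      ((1 / max ‖z‖ d ^ 2) • perp (z - w) +
        (1 / max ‖z‖ d ^ 2 - 1 / max ‖w‖ d ^ 2) • perp w) := by
    unfold cutBiotSavart
    rw [perp_sub, ← one_div_mul_one_div, ← one_div_mul_one_div]
    module
  set m := max ‖z‖ d
  set m' := max ‖w‖ d
  have hm : 0 < m := by linarith
  have hm' : 0 < m' := by linarith
  have e1 : ‖(1 / m ^ 2) • perp (z - w)‖ ≤ 1 / d ^ 2 * ‖z - w‖ := by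
    rw [norm_smul, norm_perp, Real.norm_of_nonneg (by positivity)]
    gcongr
  have e2 : ‖(1 / m ^ 2 - 1 / m' ^ 2) • perp w‖ ≤ 2 / d ^ 2 * ‖z - w‖ := by
    have : 1 / m ^ 2 - 1 / m' ^ 2 = (m' - m) * (1 / (m ^ 2 * m') + 1 / (m * m' ^ 2)) := by
      field_simp
      ring
    rw [norm_smul, norm_perp, this, Real.norm_eq_abs, abs_mul, abs_of_pos (a := _ + _)
      (by positivity)]
    calc _ ≤ ‖z - w‖ * (1 / (m ^ 2 * m') + 1 / (m * m' ^ 2)) * m' := by gcongr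
      _ = ‖z - w‖ * (1 / m ^ 2 + 1 / (m * m')) := by field_simp
      _ ≤ ‖z - w‖ * (1 / d ^ 2 + 1 / (d * d)) := by gcongr
      _ = _ := by ring
  have hc : ‖(1 / (2 * Real.pi) : ℝ)‖ ≤ 1 := by
    rw [Real.norm_of_nonneg (by positivity)]
    linarith [one_div_two_pi_le]
  rw [e, norm_smul]
  calc _ ≤ 1 * (1 / d ^ 2 * ‖z - w‖ + 2 / d ^ 2 * ‖z - w‖) := by
        gcongr
        exact (norm_add_le _ _).trans (add_le_add e1 e2)
    _ = _ := by ring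

lemma continuous_cutBiotSavart (hd : 0 < d) : Continuous (cutBiotSavart d) :=
  (LipschitzWith.of_dist_le_mul (K := (3 / d ^ 2).toNNReal) fun z w => by
    rw [Real.coe_toNNReal _ (by positivity), dist_eq_norm, dist_eq_norm]
    exact norm_cutBiotSavart_sub_le hd z w).continuous

end Kernel

section Integrability

/-- Convolving a density in `L¹ ∩ Lᵖ`, `p > 2`, with the Biot–Savart kernel yields absolutely
convergent integrals, bounded uniformly in the base point. -/
lemma exists_integral_norm_mul_biotSavart_le {p : ℝ} (hp : 2 < p) {ω : Plane → ℝ}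
    (hω : Measurable ω) (hω1 : Integrable ω)
    (hωp : eLpNorm ω (ENNReal.ofReal p) volume < ⊤) :
    ∃ B, ∀ x, Integrable (fun y => ω y • biotSavart (x - y)) ∧
      ∫ y, ‖ω y • biotSavart (x - y)‖ ≤ B := by
  have hpp : 0 < p := by linarith
  have hLp : Integrable (fun y => ‖ω y‖ ^ p) := by
    have := (MemLp.integrable_norm_rpow (p := ENNReal.ofReal p) ⟨hω.aestronglyMeasurable, hωp⟩
      (by simpa using hpp) (by simp))
    rwa [ENNReal.toReal_ofReal hpp.le] at this
  set q := p.conjExponent with hq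
  have hpq : p.HolderConjugate q := Real.HolderConjugate.conjExponent (by linarith)
  have hq2 : q < 2 := by
    rw [hq, Real.conjExponent, div_lt_iff₀ (by linarith)]
    linarith
  have hkm : Measurable fun z : Plane => ‖z‖ ^ (-q) := by fun_prop
  set k : Plane → ℝ := (Metric.ball (0 : Plane) 1).indicator fun z => ‖z‖ ^ (-q)
  have hk : Integrable k := by
    refine (integrable_indicator_iff measurableSet_ball).2 ?_
    refine integrableOn_ball_of_norm_le_rpow (C := 1) (α := q) (by simp) (by simpa using hq2)
      (Filter.Eventually.of_forall fun z => ?_) hkm.aestronglyMeasurable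
    rw [Real.norm_of_nonneg (by positivity), one_mul]
  have hk0 : ∀ z, 0 ≤ k z := fun z => Set.indicator_nonneg (fun z _ => by positivity) z
  have hbound : ∀ x y, ‖ω y • biotSavart (x - y)‖ ≤ ‖ω y‖ + ‖ω y‖ ^ p + k (x - y) := by
    intro x y
    rw [norm_smul]
    have h1 := norm_biotSavart_le (x - y)
    have h2 : 0 ≤ ‖ω y‖ ^ p := by positivity
    rcases lt_or_ge ‖x - y‖ 1 with h | h
    · have hkz : k (x - y) = ‖x - y‖ ^ (-q) := Set.indicator_of_mem (by simpa using h) _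
      have := Real.young_inequality_of_nonneg (norm_nonneg (ω y))
        (inv_nonneg.2 (norm_nonneg (x - y))) hpq
      have h3 : ‖ω y‖ ^ p / p ≤ ‖ω y‖ ^ p := div_le_self h2 hpq.lt.le
      have h4 : ‖x - y‖⁻¹ ^ q / q ≤ ‖x - y‖⁻¹ ^ q := div_le_self (by positivity) hpq.symm.lt.le
      rw [Real.inv_rpow (norm_nonneg _), ← Real.rpow_neg (norm_nonneg _), ← hkz] at h4 this
      have h5 : ‖ω y‖ * ‖biotSavart (x - y)‖ ≤ ‖ω y‖ * ‖x - y‖⁻¹ := by gcongr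
      linarith [norm_nonneg (ω y)]
    · have h5 : ‖ω y‖ * ‖biotSavart (x - y)‖ ≤ ‖ω y‖ * 1 := by
        gcongr
        exact h1.trans (inv_le_one_of_one_le₀ h)
      linarith [hk0 (x - y)]
  have hdom : ∀ x, Integrable fun y => ‖ω y‖ + ‖ω y‖ ^ p + k (x - y) := fun x =>
    (hω1.norm.add hLp).add (hk.comp_sub_left x)
  refine ⟨(∫ y, ‖ω y‖) + (∫ y, ‖ω y‖ ^ p) + ∫ z, k z, fun x => ?_⟩
  have hint : Integrable (fun y => ω y • biotSavart (x - y)) := by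
    refine (hdom x).mono' ?_ (Filter.Eventually.of_forall (hbound x))
    exact (hω.smul (measurable_biotSavart.comp
      (measurable_const.sub measurable_id))).aestronglyMeasurable
  refine ⟨hint, (integral_mono hint.norm (hdom x) (hbound x)).trans_eq ?_⟩
  rw [integral_add (f := fun y => ‖ω y‖ + ‖ω y‖ ^ p) (hω1.norm.add hLp) (hk.comp_sub_left x),
    integral_add hω1.norm hLp,
    integral_sub_left_eq_self]

lemma integrable_prod_smul_biotSavart {p : ℝ} (hp : 2 < p) {ω : Plane → ℝ}
    (hω : Measurable ω) (hω1 : Integrable ω)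
    (hωp : eLpNorm ω (ENNReal.ofReal p) volume < ⊤) :
    Integrable (fun z : Plane × Plane => (ω z.1 * ω z.2) • biotSavart (z.1 - z.2))
      (volume.prod volume) := by
  obtain ⟨B, hB⟩ := exists_integral_norm_mul_biotSavart_le hp hω hω1 hωp
  have hm : Measurable fun z : Plane × Plane => (ω z.1 * ω z.2) • biotSavart (z.1 - z.2) :=
    ((hω.comp measurable_fst).mul (hω.comp measurable_snd)).smul
      (measurable_biotSavart.comp (measurable_fst.sub measurable_snd))
  rw [integrable_prod_iff hm.aestronglyMeasurable]
  refine ⟨Filter.Eventually.of_forall fun x => ?_, ?_⟩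
  · simp only [mul_smul]
    exact (hB x).1.smul (ω x)
  · refine (hω1.norm.mul_const B).mono' hm.aestronglyMeasurable.norm.integral_prod_right'
      (Filter.Eventually.of_forall fun x => ?_)
    rw [Real.norm_of_nonneg (by positivity)]
    simp only [mul_smul, norm_smul (ω x)]
    rw [integral_const_mul]
    gcongr
    exact (hB x).2

variable {W : Type*} [NormedAddCommGroup W] [NormedSpace ℝ W]

lemma MeasureTheory.Integrable.smul_continuous_of_hasCompactSupport {ρ : Plane → ℝ}
    (hρ : Integrable ρ) (hc : HasCompactSupport ρ) {f : Plane → W} (hf : Continuous f) :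
    Integrable fun x => ρ x • f x := by
  have h : Function.support (fun x => ρ x • f x) ⊆ tsupport ρ :=
    (Function.support_smul_subset_left _ _).trans (subset_tsupport ρ)
  rw [← integrableOn_iff_integrable_of_support_subset h]
  exact hρ.integrableOn.smul_continuousOn hf.continuousOn hc.isCompact

end Integrability

section Static

variable {p : ℝ} {ρ : Plane → ℝ}

/-- Antisymmetry of the Biot–Savart kernel lets one symmetrise the self-interaction of a density
against a test field. -/
lemma integral_inner_selfVelocity (hp : 2 < p) (hρ : Measurable ρ) (hρ1 : Integrable ρ)
    (hρp : eLpNorm ρ (ENNReal.ofReal p) volume < ⊤) {G : Plane → Plane} (hG : Continuous G)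
    {M : ℝ} (hM : ∀ x, ‖G x‖ ≤ M) :
    ∫ x, ρ x * ⟪∫ y, ρ y • biotSavart (x - y), G x⟫ =
      1 / 2 * ∫ z : Plane × Plane, (ρ z.1 * ρ z.2) * ⟪biotSavart (z.1 - z.2), G z.1 - G z.2⟫
        ∂(volume.prod volume) := by
  have hint := integrable_prod_smul_biotSavart hp hρ hρ1 hρp
  obtain ⟨B, hB⟩ := exists_integral_norm_mul_biotSavart_le hp hρ hρ1 hρp
  set f : Plane × Plane → ℝ := fun z => ⟪(ρ z.1 * ρ z.2) • biotSavart (z.1 - z.2), G z.1⟫ with hf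
  have hfi : Integrable f (volume.prod volume) := by
    refine (hint.norm.mul_const M).mono' ?_ (Filter.Eventually.of_forall fun z => ?_)
    · exact hint.aestronglyMeasurable.inner (hG.comp continuous_fst).aestronglyMeasurable
    · exact (norm_inner_le_norm _ _).trans (by gcongr; exact hM _)
  have hI : ∫ x, ρ x * ⟪∫ y, ρ y • biotSavart (x - y), G x⟫ = ∫ z, f z ∂(volume.prod volume) := by
    rw [integral_prod f hfi]
    refine integral_congr_ae (Filter.Eventually.of_forall fun x => ?_)
    simp only [hf, mul_smul, inner_smul_left, RCLike.conj_to_real]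
    rw [integral_const_mul, real_inner_comm, ← integral_inner (hB x).1]
    simp only [inner_smul_right, real_inner_comm]
  have hswap := integral_prod_swap (μ := (volume : Measure Plane)) (ν := (volume : Measure Plane)) f
  have hfs : Integrable (f ∘ Prod.swap) (volume.prod volume) := hfi.swap
  have hsum : ∫ z, f z ∂(volume.prod volume) + ∫ z : Plane × Plane, f z.swap ∂(volume.prod volume)
      = ∫ z : Plane × Plane, (ρ z.1 * ρ z.2) * ⟪biotSavart (z.1 - z.2), G z.1 - G z.2⟫
        ∂(volume.prod volume) := by
    simp only [Function.comp_def] at hfs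
    rw [← integral_add hfi hfs]
    refine integral_congr_ae (Filter.Eventually.of_forall fun z => ?_)
    simp only [hf, Prod.fst_swap, Prod.snd_swap]
    rw [← neg_sub z.1 z.2, biotSavart_neg, inner_sub_right, inner_smul_left, inner_smul_left,
      inner_neg_left]
    simp only [RCLike.conj_to_real]
    ring
  rw [hI, ← hsum, hswap]
  ring

lemma integrable_smul_selfVelocity (hp : 2 < p) (hρ : Measurable ρ) (hρ1 : Integrable ρ)
    (hρp : eLpNorm ρ (ENNReal.ofReal p) volume < ⊤) :
    Integrable fun x => ρ x • ∫ y, ρ y • biotSavart (x - y) := by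
  have := (integrable_prod_smul_biotSavart hp hρ hρ1 hρp).integral_prod_left
  simpa only [mul_smul, integral_smul] using this

lemma integral_smul_selfVelocity (hp : 2 < p) (hρ : Measurable ρ) (hρ1 : Integrable ρ)
    (hρp : eLpNorm ρ (ENNReal.ofReal p) volume < ⊤) :
    ∫ x, ρ x • ∫ y, ρ y • biotSavart (x - y) = 0 := by
  refine ext_inner_left ℝ fun e => ?_
  rw [← integral_inner (integrable_smul_selfVelocity hp hρ hρ1 hρp), inner_zero_right]
  have := integral_inner_selfVelocity hp hρ hρ1 hρp (G := fun _ => e) continuous_const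
    (fun _ => le_rfl)
  simpa [inner_smul_right, real_inner_comm] using this

lemma abs_integral_inner_selfVelocity_softGrad_le (hp : 2 < p) (hρ : Measurable ρ)
    (hρ1 : Integrable ρ) (hρp : eLpNorm ρ (ENNReal.ofReal p) volume < ⊤) (hρ0 : ∀ x, 0 ≤ ρ x)
    (hc : HasCompactSupport ρ) (hone : ∫ x, ρ x = 1) {κ : ℝ} (hκ : 0 < κ) (hκ1 : κ ≤ 1)
    (b : Plane) :
    |∫ x, ρ x * ⟪∫ y, ρ y • biotSavart (x - y), softGrad κ (x - b)⟫| ≤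
      ∫ x, ρ x * softSq κ (x - b) := by
  have hgc : Continuous fun x : Plane => softGrad κ (x - b) :=
    (contDiff_softGrad hκ).continuous.comp (continuous_sub_right b)
  have hfc : Continuous fun x : Plane => softSq κ (x - b) :=
    (contDiff_softSq hκ).continuous.comp (continuous_sub_right b)
  have hφ : Integrable fun x => ρ x * softSq κ (x - b) :=
    hρ1.smul_continuous_of_hasCompactSupport hc hfc
  rw [integral_inner_selfVelocity hp hρ hρ1 hρp hgc (fun x => norm_softGrad_le hκ _), abs_mul,
    abs_of_pos (by norm_num : (0 : ℝ) < 1 / 2)]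
  have h1 : Integrable (fun z : Plane × Plane => (ρ z.1 * softSq κ (z.1 - b)) * ρ z.2)
      (volume.prod volume) := hφ.mul_prod hρ1
  have h2 : Integrable (fun z : Plane × Plane => ρ z.1 * (ρ z.2 * softSq κ (z.2 - b)))
      (volume.prod volume) := hρ1.mul_prod hφ
  have key : |∫ z : Plane × Plane, (ρ z.1 * ρ z.2) *
        ⟪biotSavart (z.1 - z.2), softGrad κ (z.1 - b) - softGrad κ (z.2 - b)⟫
          ∂(volume.prod volume)| ≤
      ∫ z : Plane × Plane, ((ρ z.1 * softSq κ (z.1 - b)) * ρ z.2 +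
        ρ z.1 * (ρ z.2 * softSq κ (z.2 - b))) ∂(volume.prod volume) := by
    rw [← Real.norm_eq_abs]
    refine norm_integral_le_of_norm_le (h1.add h2) (Filter.Eventually.of_forall fun z => ?_)
    have h0 : 0 ≤ ρ z.1 * ρ z.2 := mul_nonneg (hρ0 _) (hρ0 _)
    rw [Real.norm_eq_abs, abs_mul, abs_of_nonneg h0]
    have hz : (z.1 - b) - (z.2 - b) = z.1 - z.2 := by abel
    have := abs_inner_softGrad_sub_le hκ hκ1 (z.1 - b) (z.2 - b) (biotSavart (z.1 - z.2))
      (by rw [hz]; exact inner_biotSavart_self _) (by rw [hz]; exact norm_biotSavart_mul_norm_le _)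
    calc _ ≤ (ρ z.1 * ρ z.2) * (softSq κ (z.1 - b) + softSq κ (z.2 - b)) := by gcongr
      _ = _ := by ring
  rw [integral_add h1 h2, integral_prod_mul (fun x => ρ x * softSq κ (x - b)) ρ,
    integral_prod_mul ρ (fun x => ρ x * softSq κ (x - b)), hone] at key
  linarith

/-- The instantaneous rate of change of the regularised spread of `ρ` about its barycentre, when
`ρ` is transported by its own Biot–Savart velocity plus a bounded Lipschitz field. -/
lemma integrable_smul_velocity_and_rate_le (hp : 2 < p) (hρ : Measurable ρ)
    (hρ1 : Integrable ρ) (hρp : eLpNorm ρ (ENNReal.ofReal p) volume < ⊤) (hρ0 : ∀ x, 0 ≤ ρ x)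
    (hc : HasCompactSupport ρ) (hone : ∫ x, ρ x = 1) {κ : ℝ} (hκ : 0 < κ) (hκ1 : κ ≤ 1)
    {u F : Plane → Plane} {α L M : ℝ} (hFM : ∀ x, ‖F x‖ ≤ M)
    (hFc : Continuous F) (hFL : ∀ x y, ‖F x - F y‖ ≤ L * ‖x - y‖)
    (hu : ∀ x, ρ x ≠ 0 → u x = α • (∫ y, ρ y • biotSavart (x - y)) + F x)
    {b : Plane} (hb : b = ∫ x, ρ x • x) :
    Integrable (fun x => ρ x • u x) ∧
    (∫ x, ρ x * ⟪u x, softGrad κ (x - b)⟫) - ⟪∫ x, ρ x • u x, ∫ x, ρ x • softGrad κ (x - b)⟫ ≤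
      (|α| + 2 * L + 2 * M) * ∫ x, ρ x * softSq κ (x - b) := by
  set v : Plane → Plane := fun x => ∫ y, ρ y • biotSavart (x - y)
  have hgc : Continuous fun x : Plane => softGrad κ (x - b) :=
    (contDiff_softGrad hκ).continuous.comp (continuous_sub_right b)
  have hfc : Continuous fun x : Plane => softSq κ (x - b) :=
    (contDiff_softSq hκ).continuous.comp (continuous_sub_right b)
  have hφ : Integrable fun x => ρ x * softSq κ (x - b) :=
    hρ1.smul_continuous_of_hasCompactSupport hc hfc
  have hFi : Integrable fun x => ρ x • F x := hρ1.smul_continuous_of_hasCompactSupport hc hFc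
  have hgi : Integrable fun x => ρ x • softGrad κ (x - b) :=
    hρ1.smul_continuous_of_hasCompactSupport hc hgc
  have hvi : Integrable fun x => ρ x • v x := integrable_smul_selfVelocity hp hρ hρ1 hρp
  have hvgi : Integrable fun x => ρ x * ⟪v x, softGrad κ (x - b)⟫ := by
    refine (hvi.norm.mul_const (2 / √κ)).mono' ?_ (Filter.Eventually.of_forall fun x => ?_)
    · have := hvi.aestronglyMeasurable.inner (𝕜 := ℝ) hgc.aestronglyMeasurable
      simpa only [inner_smul_left, RCLike.conj_to_real] using this
    · have e : ρ x * ⟪v x, softGrad κ (x - b)⟫ = ⟪ρ x • v x, softGrad κ (x - b)⟫ := by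
        rw [inner_smul_left, RCLike.conj_to_real]
      rw [e]
      exact (norm_inner_le_norm _ _).trans (by gcongr; exact norm_softGrad_le hκ _)
  have hFgi : Integrable fun x => ρ x * ⟪F x, softGrad κ (x - b)⟫ :=
    hρ1.smul_continuous_of_hasCompactSupport hc (hFc.inner hgc)
  have hu' : ∀ x, ρ x • u x = α • (ρ x • v x) + ρ x • F x := by
    intro x
    by_cases h : ρ x = 0
    · simp [h]
    · rw [hu x h, smul_add, smul_comm]
  have huI : Integrable (fun x => ρ x • u x) := by
    simp only [hu']
    exact (hvi.smul α).add hFi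
  refine ⟨huI, ?_⟩
  have hmean : ∫ x, ρ x • u x = ∫ x, ρ x • F x := by
    simp only [hu']
    rw [integral_add (f := fun x => α • ρ x • v x) (hvi.smul α) hFi, integral_smul, integral_smul_selfVelocity hp hρ hρ1 hρp,
      smul_zero, zero_add]
  have hsplit : ∫ x, ρ x * ⟪u x, softGrad κ (x - b)⟫ =
      α * (∫ x, ρ x * ⟪v x, softGrad κ (x - b)⟫) + ∫ x, ρ x * ⟪F x, softGrad κ (x - b)⟫ := by
    rw [← integral_const_mul, ← integral_add (hvgi.const_mul α) hFgi]
    refine integral_congr_ae (Filter.Eventually.of_forall fun x => ?_)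
    have := congrArg (fun w => ⟪w, softGrad κ (x - b)⟫) (hu' x)
    simpa only [inner_add_left, inner_smul_left, RCLike.conj_to_real] using this
  set S := ∫ x, ρ x * softSq κ (x - b)
  have hS : 0 ≤ S := integral_nonneg fun x => mul_nonneg (hρ0 x) (softSq_nonneg hκ _)
  have hself : α * (∫ x, ρ x * ⟪v x, softGrad κ (x - b)⟫) ≤ |α| * S := by
    refine (le_abs_self _).trans ?_
    rw [abs_mul]
    gcongr
    exact abs_integral_inner_selfVelocity_softGrad_le hp hρ hρ1 hρp hρ0 hc hone hκ hκ1 b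
  have hcenter : ∫ x, ρ x • (x - b) = 0 := by
    simp only [smul_sub]
    rw [integral_sub (f := fun x => ρ x • x)
      (hρ1.smul_continuous_of_hasCompactSupport hc continuous_id) (hρ1.smul_const b),
      integral_smul_const, hone, one_smul, sub_eq_zero, hb]
  have hgS : ‖∫ x, ρ x • softGrad κ (x - b)‖ ≤ S := by
    have e : ∫ x, ρ x • softGrad κ (x - b) =
        ∫ x, ρ x • (softGrad κ (x - b) - (2 : ℝ) • (x - b)) := by
      have h2 : Integrable fun x => ρ x • ((2 : ℝ) • (x - b)) :=
        hρ1.smul_continuous_of_hasCompactSupport hc (by fun_prop)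
      simp only [smul_sub (ρ _) (softGrad κ _)]
      rw [integral_sub hgi h2]
      simp only [smul_comm (ρ _) (2 : ℝ)]
      rw [integral_smul, hcenter, smul_zero, sub_zero]
    rw [e]
    refine norm_integral_le_of_norm_le hφ (Filter.Eventually.of_forall fun x => ?_)
    rw [norm_smul, Real.norm_of_nonneg (hρ0 x)]
    exact mul_le_mul_of_nonneg_left (norm_softGrad_sub_two_smul_le hκ hκ1 _) (hρ0 x)
  have hmeanM : ‖∫ x, ρ x • F x‖ ≤ M := by
    have := norm_integral_le_of_norm_le (hρ1.mul_const M) (f := fun x => ρ x • F x)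
      (Filter.Eventually.of_forall fun x => by
        rw [norm_smul, Real.norm_of_nonneg (hρ0 x)]
        exact mul_le_mul_of_nonneg_left (hFM x) (hρ0 x))
    rwa [integral_mul_const, hone, one_mul] at this
  have hFb : ∫ x, ρ x * ⟪F x, softGrad κ (x - b)⟫ =
      (∫ x, ρ x * ⟪F x - F b, softGrad κ (x - b)⟫) + ⟪F b, ∫ x, ρ x • softGrad κ (x - b)⟫ := by
    rw [← integral_inner hgi, ← integral_add]
    · refine integral_congr_ae (Filter.Eventually.of_forall fun x => ?_)
      simp only [inner_sub_left, inner_smul_right]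
      ring
    · exact hρ1.smul_continuous_of_hasCompactSupport hc ((hFc.sub continuous_const).inner hgc)
    · exact hgi.const_inner _
  have hLip : ∫ x, ρ x * ⟪F x - F b, softGrad κ (x - b)⟫ ≤ 2 * L * S := by
    rw [← integral_const_mul]
    refine integral_mono
      (hρ1.smul_continuous_of_hasCompactSupport hc ((hFc.sub continuous_const).inner hgc))
      (hφ.const_mul _) fun x => ?_
    have h1 : ⟪F x - F b, softGrad κ (x - b)⟫ ≤ L * ‖x - b‖ * ‖softGrad κ (x - b)‖ :=
      (real_inner_le_norm _ _).trans (by gcongr; exact hFL x b)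
    have h2 := norm_mul_norm_softGrad_le hκ (x - b)
    have hL : 0 ≤ L := by
      have := (norm_nonneg _).trans (hFL (EuclideanSpace.single 0 1) 0)
      simpa using this
    calc ρ x * ⟪F x - F b, softGrad κ (x - b)⟫
        ≤ ρ x * (L * (2 * softSq κ (x - b))) := by
          refine mul_le_mul_of_nonneg_left (h1.trans ?_) (hρ0 x)
          rw [mul_assoc]
          gcongr
      _ = _ := by ring
  have hlast : ⟪F b - ∫ x, ρ x • F x, ∫ x, ρ x • softGrad κ (x - b)⟫ ≤ 2 * M * S := by
    refine (real_inner_le_norm _ _).trans ?_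
    have : ‖F b - ∫ x, ρ x • F x‖ ≤ 2 * M := by
      linarith [norm_sub_le (F b) (∫ x, ρ x • F x), hFM b]
    gcongr
    exact (norm_nonneg _).trans this
  rw [inner_sub_left] at hlast
  rw [hsplit, hmean, hFb]
  linarith

end Static

section Transport

/-- The weak form of `∂ₜρ + u·∇ρ = 0` on `[0, ∞)`. -/
def IsTransportedBy (ρ : ℝ → Plane → ℝ) (u : ℝ → Plane → Plane) : Prop :=
  ∀ φ : Plane → ℝ, ContDiff ℝ 1 φ → (∃ M, ∀ x, ‖gradient φ x‖ ≤ M) →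
    ∀ t : ℝ, 0 ≤ t → HasDerivWithinAt (fun s => ∫ x, ρ s x * φ x)
      (∫ x, ρ t x * ⟪u t x, gradient φ x⟫) (Set.Ici 0) t

variable {ρ : ℝ → Plane → ℝ} {u : ℝ → Plane → Plane} {t : ℝ}

lemma IsTransportedBy.hasDerivWithinAt_inner (h : IsTransportedBy ρ u) (e : Plane) (ht : 0 ≤ t) :
    HasDerivWithinAt (fun s => ∫ x, ρ s x * ⟪e, x⟫) (∫ x, ρ t x * ⟪u t x, e⟫) (Set.Ici 0) t := by
  have hg : ∀ x : Plane, gradient (fun x : Plane => ⟪e, x⟫) x = e := fun x =>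
    HasGradientAt.gradient (hasGradientAt_iff_hasFDerivAt.2 (innerSL ℝ e).hasFDerivAt)
  have := h (fun x => ⟪e, x⟫) (innerSL ℝ e).contDiff ⟨‖e‖, fun x => by rw [hg]⟩ t ht
  simpa only [hg] using this

lemma IsTransportedBy.differentiableWithinAt (h : IsTransportedBy ρ u)
    (hint : ∀ s, 0 ≤ s → Integrable (ρ s)) (hc : ∀ s, 0 ≤ s → HasCompactSupport (ρ s))
    {G : Plane → Plane} (hG : ContDiff ℝ 1 G) {C : NNReal} (hL : LipschitzWith C G) (ht : 0 ≤ t) :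
    DifferentiableWithinAt ℝ (fun s => ∫ x, ρ s x • G x) (Set.Ici 0) t := by
  rw [differentiableWithinAt_euclidean]
  intro i
  have hGi : ContDiff ℝ 1 fun x => G x i := by fun_prop
  have hcomp : ∀ s, 0 ≤ s → (∫ x, ρ s x • G x) i = ∫ x, ρ s x * G x i := fun s hs =>
    ((EuclideanSpace.proj (𝕜 := ℝ) i).integral_comp_comm
      ((hint s hs).smul_continuous_of_hasCompactSupport (hc s hs) hG.continuous)).symm
  refine (h _ hGi ⟨C, fun x => ?_⟩ t ht).differentiableWithinAt.congr (fun s hs => hcomp s hs)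
    (hcomp t ht)
  have hLi : LipschitzWith C fun x => G x i := LipschitzWith.of_dist_le_mul fun x y =>
    le_trans (by simpa [dist_eq_norm] using PiLp.norm_apply_le (G x - G y) i) (hL.dist_le_mul x y)
  rw [gradient, LinearIsometryEquiv.norm_map]
  exact norm_fderiv_le_of_lipschitz ℝ hLi

lemma IsTransportedBy.hasDerivWithinAt_barycenter (h : IsTransportedBy ρ u)
    (hint : ∀ s, 0 ≤ s → Integrable (ρ s)) (hc : ∀ s, 0 ≤ s → HasCompactSupport (ρ s))
    (ht : 0 ≤ t) (hu : Integrable fun x => ρ t x • u t x) :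
    HasDerivWithinAt (fun s => ∫ x, ρ s x • x) (∫ x, ρ t x • u t x) (Set.Ici 0) t := by
  have hd := (h.differentiableWithinAt hint hc contDiff_id LipschitzWith.id ht).hasDerivWithinAt
  refine hd.congr_deriv (ext_inner_left ℝ fun e => ?_)
  have hinner : ∀ s, 0 ≤ s → ⟪e, ∫ x, ρ s x • x⟫ = ∫ x, ρ s x * ⟪e, x⟫ := fun s hs => by
    rw [← integral_inner (f := fun x => ρ s x • x)
      ((hint s hs).smul_continuous_of_hasCompactSupport (hc s hs) continuous_id)]
    simp only [inner_smul_right]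
  have huniq := ((uniqueDiffOn_Ici (0 : ℝ)) t ht).eq_deriv _
    ((hasDerivWithinAt_const t (Set.Ici 0) e).inner ℝ hd)
    ((h.hasDerivWithinAt_inner e ht).congr hinner (hinner t ht))
  rw [inner_zero_left, add_zero] at huniq
  rw [← integral_inner hu]
  simpa only [inner_smul_right, real_inner_comm] using huniq

lemma IsTransportedBy.hasDerivWithinAt_softSq (h : IsTransportedBy ρ u)
    (hint : ∀ s, 0 ≤ s → Integrable (ρ s)) (hc : ∀ s, 0 ≤ s → HasCompactSupport (ρ s))
    (hρ0 : ∀ s, 0 ≤ s → ∀ x, 0 ≤ ρ s x) (hone : ∀ s, 0 ≤ s → ∫ x, ρ s x = 1)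
    {X : ℝ → Plane} (hX : ∀ s, X s = ∫ x, ρ s x • x) {κ : ℝ} (hκ : 0 < κ)
    (ht : 0 ≤ t) (hu : Integrable fun x => ρ t x • u t x) :
    HasDerivWithinAt (fun s => ∫ x, ρ s x * softSq κ (x - X s))
      ((∫ x, ρ t x * ⟪u t x, softGrad κ (x - X t)⟫) -
        ⟪∫ x, ρ t x • u t x, ∫ x, ρ t x • softGrad κ (x - X t)⟫) (Set.Ici 0) t := by
  set b := X t with hb
  have hgC : ContDiff ℝ 1 fun x : Plane => softGrad κ (x - b) :=
    (contDiff_softGrad hκ).comp (contDiff_id.sub contDiff_const)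
  have hfC : ∀ c, ContDiff ℝ 1 fun x : Plane => softSq κ (x - c) := fun c =>
    (contDiff_softSq hκ).comp (contDiff_id.sub contDiff_const)
  have hgrad : ∀ x : Plane, gradient (fun x : Plane => softSq κ (x - b)) x = softGrad κ (x - b) :=
    fun x => HasGradientAt.gradient (hasGradientAt_iff_hasFDerivAt.2
      (hasFDerivAt_comp_sub b |>.2 (hasFDerivAt_softSq hκ (x - b))))
  have hP : HasDerivWithinAt (fun s => ∫ x, ρ s x * softSq κ (x - b))
      (∫ x, ρ t x * ⟪u t x, softGrad κ (x - b)⟫) (Set.Ici 0) t := by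
    have := h _ (hfC b) ⟨2 / √κ, fun x => by rw [hgrad]; exact norm_softGrad_le hκ _⟩ t ht
    simpa only [hgrad] using this
  have hgL : LipschitzWith 4 fun x : Plane => softGrad κ (x - b) :=
    LipschitzWith.of_dist_le_mul fun x y => by
      simpa [dist_eq_norm] using norm_softGrad_sub_le hκ (x - b) (y - b)
  have hQ := (h.differentiableWithinAt hint hc hgC hgL ht).hasDerivWithinAt
  have hX' : HasDerivWithinAt X (∫ x, ρ t x • u t x) (Set.Ici 0) t := by
    have := h.hasDerivWithinAt_barycenter hint hc ht hu
    rwa [← funext hX] at this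
  set Q : ℝ → Plane := fun s => ∫ x, ρ s x • softGrad κ (x - b) with hQdef
  set R : ℝ → ℝ := fun s => (∫ x, ρ s x * softSq κ (x - X s)) -
    (∫ x, ρ s x * softSq κ (x - b)) + ⟪X s - b, Q s⟫ with hR
  have hRbound : ∀ s, 0 ≤ s → |R s| ≤ 4 * ‖X s - b‖ ^ 2 := by
    intro s hs
    have i1 : Integrable fun x => ρ s x * softSq κ (x - X s) :=
      (hint s hs).smul_continuous_of_hasCompactSupport (hc s hs) (hfC _).continuous
    have i2 : Integrable fun x => ρ s x * softSq κ (x - b) :=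
      (hint s hs).smul_continuous_of_hasCompactSupport (hc s hs) (hfC _).continuous
    have i3 : Integrable fun x => ρ s x • softGrad κ (x - b) :=
      (hint s hs).smul_continuous_of_hasCompactSupport (hc s hs) hgC.continuous
    have e : R s = ∫ x, (ρ s x * softSq κ (x - X s) - ρ s x * softSq κ (x - b) +
        ⟪X s - b, ρ s x • softGrad κ (x - b)⟫) := by
      rw [integral_add (f := fun x => ρ s x * softSq κ (x - X s) - ρ s x * softSq κ (x - b))
        (i1.sub i2) (i3.const_inner _), integral_sub i1 i2, integral_inner i3]
    have := norm_integral_le_of_norm_le ((hint s hs).mul_const (4 * ‖X s - b‖ ^ 2))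
      (f := fun x => ρ s x * softSq κ (x - X s) - ρ s x * softSq κ (x - b) +
        ⟪X s - b, ρ s x • softGrad κ (x - b)⟫) (Filter.Eventually.of_forall fun x => ?_)
    · rwa [← e, integral_mul_const, hone s hs, one_mul] at this
    · have key := abs_softSq_sub_le hκ (x - b) (b - X s)
      rw [sub_add_sub_cancel, norm_sub_rev b] at key
      have e2 : ρ s x * softSq κ (x - X s) - ρ s x * softSq κ (x - b) +
          ⟪X s - b, ρ s x • softGrad κ (x - b)⟫ = ρ s x *
          (softSq κ (x - X s) - softSq κ (x - b) - ⟪softGrad κ (x - b), b - X s⟫) := by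
        rw [inner_smul_right, ← neg_sub b (X s), inner_neg_left, real_inner_comm]
        ring
      rw [e2, norm_mul, Real.norm_of_nonneg (hρ0 s hs x), Real.norm_eq_abs]
      exact mul_le_mul_of_nonneg_left key (hρ0 s hs x)
  have hRt : R t = 0 := by
    have := hRbound t ht
    rw [← hb, sub_self, norm_zero] at this
    exact abs_eq_zero.1 (le_antisymm (by simpa using this) (abs_nonneg _))
  have hR' : HasDerivWithinAt R 0 (Set.Ici 0) t := by
    rw [hasDerivWithinAt_iff_isLittleO]
    simp only [hRt, sub_zero, smul_zero]
    have hO : (fun s => X s - b) =O[nhdsWithin t (Set.Ici 0)] fun s => s - t :=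
      hX'.hasFDerivWithinAt.isBigO_sub
    have ho1 : (fun s => X s - b) =o[nhdsWithin t (Set.Ici 0)] fun _ => (1 : ℝ) := by
      rw [Asymptotics.isLittleO_one_iff]
      have := hX'.continuousWithinAt.tendsto.sub_const b
      rwa [← hb, sub_self] at this
    have hoo : (fun s => ‖X s - b‖ * ‖X s - b‖) =o[nhdsWithin t (Set.Ici 0)] fun s => 1 * (s - t) :=
      ho1.norm_left.mul_isBigO hO.norm_left
    simp only [one_mul] at hoo
    refine Asymptotics.IsBigO.trans_isLittleO ?_ hoo
    refine Asymptotics.IsBigO.of_bound 4 ?_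
    filter_upwards [self_mem_nhdsWithin] with s hs
    simpa [pow_two] using hRbound s hs
  have hfinal := (hP.sub ((hX'.sub_const b).inner ℝ hQ)).add hR'
  refine (hfinal.congr_deriv ?_).congr_of_mem (fun s _ => ?_) ht
  · simp [← hb]
    rfl
  · simp only [hR, Pi.add_apply, Pi.sub_apply]
    ring

end Transport

section Conclusion

lemma le_exp_mul_of_hasDerivWithinAt_le {f f' : ℝ → ℝ} {K T : ℝ} (hT : 0 ≤ T)
    (hf : ∀ s ∈ Set.Icc 0 T, HasDerivWithinAt f (f' s) (Set.Ici 0) s)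
    (hle : ∀ s ∈ Set.Icc 0 T, f' s ≤ K * f s) : f T ≤ Real.exp (K * T) * f 0 := by
  have key := le_gronwallBound_of_liminf_deriv_right_le (f := f) (f' := f') (δ := f 0) (K := K)
    (ε := 0) (a := 0) (b := T)
    (fun s hs => (hf s hs).continuousWithinAt.mono Set.Icc_subset_Ici_self)
    (fun s hs r hr => ?_) le_rfl
    (fun s hs => by simpa using hle s (Set.Ico_subset_Icc_self hs)) T ⟨hT, le_rfl⟩
  · rw [gronwallBound_ε0, sub_zero] at key
    linarith
  · exact ((hf s (Set.Ico_subset_Icc_self hs)).mono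
      (Set.Ici_subset_Ici.2 hs.1)).liminf_right_slope_le hr

lemma tendsto_softSq {V : Type*} [NormedAddCommGroup V] (x : V) :
    Filter.Tendsto (fun κ : ℝ => softSq κ x) (nhdsWithin 0 (Set.Ioi 0)) (nhds (‖x‖ ^ 2)) := by
  have hc : ContinuousAt (fun κ : ℝ => softSq κ x) 0 := by
    unfold softSq softRadius
    refine ContinuousAt.div (by fun_prop) (by fun_prop) (by positivity)
  have h0 : softSq 0 x = ‖x‖ ^ 2 := by
    simp [softSq, softRadius]
    ring
  have := hc.tendsto
  rw [h0] at this
  exact this.mono_left nhdsWithin_le_nhds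

lemma tendsto_integral_mul_softSq {ρ : Plane → ℝ} (hρ1 : Integrable ρ) (hρ0 : ∀ x, 0 ≤ ρ x)
    (hc : HasCompactSupport ρ) (b : Plane) :
    Filter.Tendsto (fun κ : ℝ => ∫ x, ρ x * softSq κ (x - b)) (nhdsWithin 0 (Set.Ioi 0))
      (nhds (∫ x, ρ x * ‖x - b‖ ^ 2)) := by
  refine tendsto_integral_filter_of_dominated_convergence (fun x => ρ x * ‖x - b‖ ^ 2) ?_ ?_ ?_ ?_
  · filter_upwards [self_mem_nhdsWithin] with κ hκ
    exact hρ1.aestronglyMeasurable.mul ((contDiff_softSq (V := Plane) hκ).continuous.comp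
      (continuous_sub_right b)).aestronglyMeasurable
  · filter_upwards [self_mem_nhdsWithin] with κ hκ
    refine Filter.Eventually.of_forall fun x => ?_
    rw [Real.norm_of_nonneg (mul_nonneg (hρ0 x) (softSq_nonneg hκ _))]
    exact mul_le_mul_of_nonneg_left (softSq_le_norm_sq hκ _) (hρ0 x)
  · exact hρ1.smul_continuous_of_hasCompactSupport hc (f := fun x => ‖x - b‖ ^ 2) (by fun_prop)
  · exact Filter.Eventually.of_forall fun x => (tendsto_softSq (x - b)).const_mul (ρ x)

/-- The second moment about the barycentre is the smallest one. -/
lemma integral_norm_sub_barycenter_sq_le {ρ : Plane → ℝ} (hρ1 : Integrable ρ)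
    (hc : HasCompactSupport ρ) (hone : ∫ x, ρ x = 1) {b : Plane} (hb : b = ∫ x, ρ x • x)
    (y : Plane) : ∫ x, ρ x * ‖x - b‖ ^ 2 ≤ ∫ x, ρ x * ‖x - y‖ ^ 2 := by
  have i1 : Integrable fun x => ρ x • x :=
    hρ1.smul_continuous_of_hasCompactSupport hc continuous_id
  have i2 : Integrable fun x => ρ x * ‖x - b‖ ^ 2 :=
    hρ1.smul_continuous_of_hasCompactSupport hc (f := fun x => ‖x - b‖ ^ 2) (by fun_prop)
  have i3 : Integrable fun x => ρ x • x - ρ x • b := i1.sub (hρ1.smul_const b)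
  have hcenter : ∫ x, (ρ x • x - ρ x • b) = 0 := by
    rw [integral_sub i1 (hρ1.smul_const b), integral_smul_const, hone, one_smul, ← hb, sub_self]
  have e : ∀ x, ρ x * ‖x - y‖ ^ 2 =
      ρ x * ‖x - b‖ ^ 2 + 2 * ⟪b - y, ρ x • x - ρ x • b⟫ + ρ x * ‖b - y‖ ^ 2 := by
    intro x
    rw [← sub_add_sub_cancel x b y, norm_add_sq_real, ← smul_sub, inner_smul_right,
      real_inner_comm]
    ring
  simp only [e]
  rw [integral_add (f := fun x => ρ x * ‖x - b‖ ^ 2 + 2 * ⟪b - y, ρ x • x - ρ x • b⟫)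
    (i2.add ((i3.const_inner _).const_mul 2)) (hρ1.mul_const _), integral_add i2
    ((i3.const_inner _).const_mul 2), integral_const_mul, integral_inner i3, hcenter,
    integral_mul_const, hone, inner_zero_right]
  linarith [sq_nonneg ‖b - y‖]

variable {d : ℝ}

lemma integrable_smul_cutBiotSavart (hd : 0 < d) {ω : Plane → ℝ} (hω : Integrable ω) (x : Plane) :
    Integrable fun y => ω y • cutBiotSavart d (x - y) := by
  refine (hω.norm.mul_const (1 / d)).mono' (hω.aestronglyMeasurable.smul
    ((continuous_cutBiotSavart hd).comp (continuous_sub_left x)).aestronglyMeasurable)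
    (Filter.Eventually.of_forall fun y => ?_)
  rw [norm_smul]
  gcongr
  exact norm_cutBiotSavart_le hd _

lemma norm_integral_smul_cutBiotSavart_le (hd : 0 < d) {ω : Plane → ℝ} (hω : Integrable ω)
    (x : Plane) : ‖∫ y, ω y • cutBiotSavart d (x - y)‖ ≤ (∫ y, ‖ω y‖) * (1 / d) := by
  rw [← integral_mul_const]
  refine norm_integral_le_of_norm_le (hω.norm.mul_const _) (Filter.Eventually.of_forall fun y => ?_)
  rw [norm_smul]
  gcongr
  exact norm_cutBiotSavart_le hd _

lemma norm_integral_smul_cutBiotSavart_sub_le (hd : 0 < d) {ω : Plane → ℝ} (hω : Integrable ω)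
    (x x' : Plane) :
    ‖(∫ y, ω y • cutBiotSavart d (x - y)) - ∫ y, ω y • cutBiotSavart d (x' - y)‖ ≤
      (∫ y, ‖ω y‖) * (3 / d ^ 2 * ‖x - x'‖) := by
  rw [← integral_sub (integrable_smul_cutBiotSavart hd hω x)
    (integrable_smul_cutBiotSavart hd hω x'), ← integral_mul_const]
  refine norm_integral_le_of_norm_le (hω.norm.mul_const _) (Filter.Eventually.of_forall fun y => ?_)
  rw [← smul_sub, norm_smul]
  gcongr
  simpa using norm_cutBiotSavart_sub_le hd (x - y) (x' - y)

lemma integral_norm_eq_abs_of_mul_nonneg {a : ℝ} (ha : a ≠ 0) {ω : Plane → ℝ}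
    (hsign : ∀ x, 0 ≤ a * ω x) (hint : ∫ x, ω x = a) : ∫ x, ‖ω x‖ = |a| := by
  have h : ∀ x, ‖ω x‖ = |a|⁻¹ * (a * ω x) := by
    intro x
    rw [← abs_of_nonneg (hsign x), abs_mul, inv_mul_cancel_left₀ (abs_ne_zero.2 ha),
      Real.norm_eq_abs]
  simp only [h]
  rw [integral_const_mul, integral_const_mul, hint, ← abs_mul_abs_self a,
    inv_mul_cancel_left₀ (abs_ne_zero.2 ha)]

end Conclusion

theorem stmt4 (N : ℕ) (hN : 1 ≤ N) (δ A : ℝ) (hδ : 0 < δ) (hA : 0 < A) :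
    ∃ C > (0:ℝ),
      ∀ (a : Fin N → ℝ), (∀ i, a i ≠ 0) → (∀ i, |a i| ≤ A) →
      ∀ p γ Λ R : ℝ, 2 < p → 0 < γ → 0 < Λ → 0 < R →
      ∀ ε : ℝ, 0 < ε →
      ∀ (ωi : Fin N → ℝ → EuclideanSpace ℝ (Fin 2) → ℝ)
        (u : ℝ → EuclideanSpace ℝ (Fin 2) → EuclideanSpace ℝ (Fin 2))
        (X : Fin N → ℝ → EuclideanSpace ℝ (Fin 2))
        (Ybar : Fin N → EuclideanSpace ℝ (Fin 2)),
        -- regularity: each component is measurable with compact support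
        (∀ i, ∀ t : ℝ, 0 ≤ t → Measurable (ωi i t)) →
        (∀ i, ∀ t : ℝ, 0 ≤ t → HasCompactSupport (ωi i t)) →
        -- definite sign: aᵢ·ωᵢ ≥ 0
        (∀ i, ∀ t : ℝ, 0 ≤ t → ∀ x, 0 ≤ a i * ωi i t x) →
        -- conserved intensity: ∫ ωᵢ = aᵢ
        (∀ i, ∀ t : ℝ, 0 ≤ t → (∫ x, ωi i t x) = a i) →
        -- conserved Lᵖ norm, finite
        (∀ i, ∀ t : ℝ, 0 ≤ t →
          eLpNorm (ωi i t) (ENNReal.ofReal p) volume = eLpNorm (ωi i 0) (ENNReal.ofReal p) volume) →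
        (∀ i, eLpNorm (ωi i 0) (ENNReal.ofReal p) volume < ⊤) →
        -- scaling assumption ‖ω(0)‖_{Lᵖ} ≤ Λ ε^{−γ}
        eLpNorm (fun x => ∑ i, ωi i 0 x) (ENNReal.ofReal p) volume ≤ ENNReal.ofReal (Λ * ε ^ (-γ)) →
        -- Biot–Savart velocity
        (∀ t x, u t x = ∫ y, (∑ j, ωi j t y) • biotSavart (x - y)) →
        -- weak formulation of the transport equations ∂ₜωᵢ + u·∇ωᵢ = 0
        (∀ i, ∀ φ : EuclideanSpace ℝ (Fin 2) → ℝ, ContDiff ℝ 1 φ →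
          (∃ M, ∀ x, ‖gradient φ x‖ ≤ M) →
          ∀ t : ℝ, 0 ≤ t → HasDerivWithinAt (fun s => ∫ x, ωi i s x * φ x)
            (∫ x, ωi i t x * ⟪u t x, gradient φ x⟫) (Set.Ici 0) t) →
        -- vorticity centers
        (∀ i t, X i t = (a i)⁻¹ • ∫ x, ωi i t x • x) →
        -- initial support in B_R(Xᵢ(0))
        (∀ i, Function.support (ωi i 0) ⊆ Metric.ball (X i 0) R) →
        -- initial separation of the supports by δ
        (∀ i j, i ≠ j → ∀ x ∈ Function.support (ωi i 0), ∀ y ∈ Function.support (ωi j 0),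
          δ ≤ dist x y) →
        -- initial concentration around the points Ȳᵢ at scale ε
        (∀ i, (a i)⁻¹ * ∫ x, ‖x - Ybar i‖ ^ 2 * ωi i 0 x ≤ ε ^ 2) →
        ∀ i : Fin N, ∀ t : ℝ, 0 ≤ t →
          (∀ s ∈ Set.Icc (0:ℝ) t, ∀ k j : Fin N, k ≠ j →
            ∀ x ∈ Function.support (ωi k s), ∀ y ∈ Function.support (ωi j s), δ / 2 ≤ dist x y) →
          (a i)⁻¹ * (∫ x, ‖x - X i t‖ ^ 2 * ωi i t x) ≤ Real.exp (2 * C * t) * ε ^ 2 := by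
  have hd : 0 < δ / 2 := by positivity
  have hNA : (0 : ℝ) ≤ N * A := by positivity
  set d := δ / 2
  set L : ℝ := N * A * (3 / d ^ 2) with hLdef
  set M : ℝ := N * A * (1 / d) with hMdef
  have hL0 : 0 ≤ L := by positivity
  have hM0 : 0 ≤ M := by positivity
  refine ⟨A + 2 * L + 2 * M, by positivity, ?_⟩
  intro a ha haA p γ Λ R hp _ _ _ ε _ ωi u X Ybar hmeas hcs hsign hmass hLp hLp0 _ hu hweak hX _ _
    hconc i T hT hsep
  have hωint : ∀ j s, 0 ≤ s → Integrable (ωi j s) := fun j s hs =>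
    not_imp_comm.1 integral_undef (by rw [hmass j s hs]; exact ha j)
  have hωLp : ∀ j s, 0 ≤ s → eLpNorm (ωi j s) (ENNReal.ofReal p) volume < ⊤ := fun j s hs => by
    rw [hLp j s hs]
    exact hLp0 j
  have hωabs : ∀ j s, 0 ≤ s → ∫ y, ‖ωi j s y‖ ≤ A := fun j s hs =>
    (integral_norm_eq_abs_of_mul_nonneg (ha j) (hsign j s hs) (hmass j s hs)).trans_le (haA j)
  set ρ : ℝ → Plane → ℝ := fun s x => (a i)⁻¹ * ωi i s x with hρdef
  have hρm : ∀ s, 0 ≤ s → Measurable (ρ s) := fun s hs => (hmeas i s hs).const_mul _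
  have hρint : ∀ s, 0 ≤ s → Integrable (ρ s) := fun s hs => (hωint i s hs).const_mul _
  have hρc : ∀ s, 0 ≤ s → HasCompactSupport (ρ s) := fun s hs => (hcs i s hs).mul_left
  have hρ0 : ∀ s, 0 ≤ s → ∀ x, 0 ≤ ρ s x := fun s hs x => by
    have : ρ s x = (a i * ωi i s x) / a i ^ 2 := by
      simp only [hρdef]
      field_simp [ha i]
    rw [this]
    exact div_nonneg (hsign i s hs x) (sq_nonneg _)
  have hρone : ∀ s, 0 ≤ s → ∫ x, ρ s x = 1 := fun s hs => by
    rw [integral_const_mul, hmass i s hs, inv_mul_cancel₀ (ha i)]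
  have hρLp : ∀ s, 0 ≤ s → eLpNorm (ρ s) (ENNReal.ofReal p) volume < ⊤ := fun s hs =>
    ((MemLp.const_mul ⟨(hmeas i s hs).aestronglyMeasurable, hωLp i s hs⟩ (a i)⁻¹)).2
  have hρX : ∀ s, X i s = ∫ x, ρ s x • x := fun s => by
    simp only [hρdef, mul_smul]
    rw [integral_smul, hX]
  have hρw : IsTransportedBy ρ u := by
    intro φ hφ hφ' s hs
    have := (hweak i φ hφ hφ' s hs).const_mul (a i)⁻¹
    simpa only [hρdef, mul_assoc, integral_const_mul] using this
  set F : ℝ → Plane → Plane := fun s x =>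
    ∑ j ∈ Finset.univ.erase i, ∫ y, ωi j s y • cutBiotSavart d (x - y) with hFdef
  have hcard : ((Finset.univ.erase i).card : ℝ) ≤ N := by
    exact_mod_cast (Finset.card_le_univ _).trans_eq (Fintype.card_fin N)
  have hFM : ∀ s, 0 ≤ s → ∀ x, ‖F s x‖ ≤ M := fun s hs x => by
    refine (norm_sum_le_of_le _ (n := fun _ => A * (1 / d)) fun j _ =>
      (norm_integral_smul_cutBiotSavart_le hd (hωint j s hs) x).trans ?_).trans ?_
    · gcongr
      exact hωabs j s hs
    · rw [Finset.sum_const, nsmul_eq_mul, hMdef, mul_assoc]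
      gcongr
  have hFL : ∀ s, 0 ≤ s → ∀ x y, ‖F s x - F s y‖ ≤ L * ‖x - y‖ := fun s hs x y => by
    rw [hFdef, ← Finset.sum_sub_distrib]
    refine (norm_sum_le_of_le _ (n := fun _ => A * (3 / d ^ 2 * ‖x - y‖)) fun j _ =>
      (norm_integral_smul_cutBiotSavart_sub_le hd (hωint j s hs) x y).trans ?_).trans ?_
    · gcongr
      exact hωabs j s hs
    · rw [Finset.sum_const, nsmul_eq_mul, hLdef, mul_assoc, mul_assoc]
      gcongr
  have hFc : ∀ s, 0 ≤ s → Continuous (F s) := fun s hs =>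
    (LipschitzWith.of_dist_le_mul (K := L.toNNReal) fun x y => by
      rw [Real.coe_toNNReal _ hL0, dist_eq_norm, dist_eq_norm]
      exact hFL s hs x y).continuous
  have hudec : ∀ s ∈ Set.Icc 0 T, ∀ x, ρ s x ≠ 0 →
      u s x = a i • (∫ y, ρ s y • biotSavart (x - y)) + F s x := by
    intro s hs x hx
    have hxi : ωi i s x ≠ 0 := right_ne_zero_of_mul hx
    have hKint : ∀ j, Integrable fun y => ωi j s y • biotSavart (x - y) := fun j => by
      obtain ⟨B, hB⟩ := exists_integral_norm_mul_biotSavart_le hp (hmeas j s hs.1)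
        (hωint j s hs.1) (hωLp j s hs.1)
      exact (hB x).1
    rw [hu]
    simp only [Finset.sum_smul]
    rw [integral_finsetSum _ fun j _ => hKint j, ← Finset.add_sum_erase _ _ (Finset.mem_univ i)]
    congr 1
    · rw [← integral_smul]
      simp only [hρdef, smul_smul, mul_inv_cancel_left₀ (ha i)]
    · refine Finset.sum_congr rfl fun j hj => integral_congr_ae (Filter.Eventually.of_forall
        fun y => ?_)
      by_cases hy : ωi j s y = 0
      · simp [hy]
      · have := hsep s hs i j (Finset.ne_of_mem_erase hj).symm x hxi y hy
        simp only [cutBiotSavart_eq (dist_eq_norm x y ▸ this)]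
  have hW : ∀ κ : ℝ, 0 < κ → κ ≤ 1 → ∫ x, ρ T x * softSq κ (x - X i T) ≤
      Real.exp (2 * (A + 2 * L + 2 * M) * T) * ε ^ 2 := by
    intro κ hκ hκ1
    have hrate := fun s (hs : s ∈ Set.Icc 0 T) =>
      integrable_smul_velocity_and_rate_le hp (hρm s hs.1) (hρint s hs.1) (hρLp s hs.1)
        (hρ0 s hs.1) (hρc s hs.1) (hρone s hs.1) hκ hκ1 (hFM s hs.1) (hFc s hs.1) (hFL s hs.1)
        (hudec s hs) (hρX s)
    have hgron := le_exp_mul_of_hasDerivWithinAt_le hT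
      (fun s hs => hρw.hasDerivWithinAt_softSq hρint hρc hρ0 hρone hρX hκ hs.1 (hrate s hs).1)
      (fun s hs => (hrate s hs).2)
    have hinit : ∫ x, ρ 0 x * softSq κ (x - X i 0) ≤ ε ^ 2 := by
      have h1 : ∫ x, ρ 0 x * softSq κ (x - X i 0) ≤ ∫ x, ρ 0 x * ‖x - X i 0‖ ^ 2 := by
        refine integral_mono
          ((hρint 0 le_rfl).smul_continuous_of_hasCompactSupport (hρc 0 le_rfl)
            ((contDiff_softSq hκ).continuous.comp (continuous_sub_right _)))
          ((hρint 0 le_rfl).smul_continuous_of_hasCompactSupport (hρc 0 le_rfl)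
            (f := fun x => ‖x - X i 0‖ ^ 2) (by fun_prop)) fun x => ?_
        exact mul_le_mul_of_nonneg_left (softSq_le_norm_sq hκ _) (hρ0 0 le_rfl x)
      refine (h1.trans (integral_norm_sub_barycenter_sq_le (hρint 0 le_rfl) (hρc 0 le_rfl)
        (hρone 0 le_rfl) (hρX 0) (Ybar i))).trans ((le_of_eq ?_).trans (hconc i))
      rw [← integral_const_mul]
      simp only [hρdef, mul_assoc, mul_comm (ωi i 0 _)]
    refine hgron.trans (mul_le_mul (Real.exp_le_exp.2 ?_) hinit ?_ (Real.exp_pos _).le)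
    · gcongr
      nlinarith [haA i]
    · exact integral_nonneg fun x => mul_nonneg (hρ0 0 le_rfl x) (softSq_nonneg hκ _)
  have hgoal : (a i)⁻¹ * (∫ x, ‖x - X i T‖ ^ 2 * ωi i T x) = ∫ x, ρ T x * ‖x - X i T‖ ^ 2 := by
    rw [← integral_const_mul]
    simp only [hρdef, mul_assoc, mul_comm (ωi i T _)]
  rw [hgoal]
  refine le_of_tendsto (tendsto_integral_mul_softSq (hρint T hT) (hρ0 T hT) (hρc T hT) _) ?_
  filter_upwards [Ioc_mem_nhdsGT (zero_lt_one' ℝ)] with κ hκ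
  exact hW κ hκ.1 hκ.2
end

section
/- For every measurable set A ⊂ ℝ² of finite Lebesgue measure and every x ∈ ℝ², one has ∫_A |x − y|^{−1} dy ≤ 2 √(π |A|); equality holds when A is a disk centered at x. -/
open MeasureTheory
open scoped ENNReal

/-- The area of a disk, as a real number. -/
lemma volume_real_ball_fin_two (x : EuclideanSpace ℝ (Fin 2)) {r : ℝ} (hr : 0 ≤ r) :
    volume.real (Metric.ball x r) = Real.pi * r ^ 2 := by
  rw [measureReal_def, EuclideanSpace.volume_ball_fin_two, ENNReal.toReal_mul, ENNReal.toReal_pow,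
    ENNReal.toReal_ofReal hr, ENNReal.toReal_ofReal Real.pi_pos.le, mul_comm]

/-- The potential `|x - y|⁻¹` of a disk at its center is `2πr`. -/
lemma setIntegral_ball_inv_norm_sub (x : EuclideanSpace ℝ (Fin 2)) {r : ℝ} (hr : 0 < r) :
    ∫ y in Metric.ball x r, ‖x - y‖⁻¹ = 2 * Real.pi * r := by
  have hind : ∀ y, (Metric.ball x r).indicator (fun y => ‖x - y‖⁻¹) y
      = (fun z => (Set.Iio r).indicator (fun t : ℝ => t⁻¹) ‖z‖) (x - y) := fun y => by
    by_cases h : ‖x - y‖ < r <;> simp [Set.indicator, dist_eq_norm, norm_sub_rev y x, h]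
  have hradial : ∫ y in Set.Ioi (0 : ℝ), y * (Set.Iio r).indicator (fun t : ℝ => t⁻¹) y = r := by
    have h : ∀ y ∈ Set.Ioi (0 : ℝ), y * (Set.Iio r).indicator (fun t : ℝ => t⁻¹) y
        = (Set.Iio r).indicator (fun _ => (1 : ℝ)) y := fun y hy => by
      have : y ≠ 0 := (Set.mem_Ioi.1 hy).ne'
      by_cases hyr : y < r <;> simp [hyr, this]
    rw [setIntegral_congr_fun measurableSet_Ioi h, setIntegral_indicator measurableSet_Iio,
      Set.Ioi_inter_Iio]
    simp [hr.le]
  rw [← integral_indicator measurableSet_ball, integral_congr_ae (.of_forall hind),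
    integral_sub_left_eq_self (fun z => (Set.Iio r).indicator (fun t : ℝ => t⁻¹) ‖z‖) volume x,
    integral_fun_norm_addHaar]
  simp only [finrank_euclideanSpace, Fintype.card_fin, Nat.add_one_sub_one, pow_one, smul_eq_mul,
    hradial, nsmul_eq_mul, volume_real_ball_fin_two _ zero_le_one]
  push_cast
  ring

lemma integrableOn_ball_inv_norm_sub (x : EuclideanSpace ℝ (Fin 2)) {r : ℝ} (hr : 0 < r) :
    IntegrableOn (fun y => ‖x - y‖⁻¹) (Metric.ball x r) := by
  by_contra h
  have := setIntegral_ball_inv_norm_sub x hr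
  rw [integral_undef h] at this
  have : 0 < 2 * Real.pi * r := by positivity
  linarith

/-- Comparison of the potential of a set of finite area with that of a disk of arbitrary radius;
the right side is minimal when the two areas agree. -/
lemma setIntegral_inv_norm_sub_le {A : Set (EuclideanSpace ℝ (Fin 2))} (hA : volume A < ⊤)
    (x : EuclideanSpace ℝ (Fin 2)) {r : ℝ} (hr : 0 < r) :
    ∫ y in A, ‖x - y‖⁻¹ ≤ volume.real A * r⁻¹ + Real.pi * r := by
  set g := (Metric.ball x r).indicator (fun y => ‖x - y‖⁻¹ - r⁻¹) with hg
  have hconst : IntegrableOn (fun _ => r⁻¹) (Metric.ball x r) volume :=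
    integrableOn_const measure_ball_lt_top.ne
  have hgint : Integrable g :=
    ((integrableOn_ball_inv_norm_sub x hr).sub hconst).integrable_indicator measurableSet_ball
  have hg0 : 0 ≤ᵐ[volume] g := by
    filter_upwards [Measure.ae_ne volume x] with y hy
    refine Set.indicator_apply_nonneg fun hyr => sub_nonneg.2 ?_
    rw [Metric.mem_ball', dist_eq_norm] at hyr
    exact inv_anti₀ (norm_pos_iff.2 (sub_ne_zero.2 hy.symm)) hyr.le
  have hgtot : ∫ y, g y = Real.pi * r := by
    rw [hg, integral_indicator measurableSet_ball,
      integral_sub (integrableOn_ball_inv_norm_sub x hr) hconst,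
      setIntegral_ball_inv_norm_sub x hr, setIntegral_const, volume_real_ball_fin_two x hr.le,
      smul_eq_mul]
    field_simp
    ring
  have hle : ∀ y, ‖x - y‖⁻¹ ≤ r⁻¹ + g y := fun y => by
    by_cases hy : y ∈ Metric.ball x r
    · simp [hg, hy]
    · rw [hg, Set.indicator_of_notMem hy, add_zero]
      rw [Metric.mem_ball', dist_eq_norm, not_lt] at hy
      exact inv_anti₀ hr hy
  have hAconst : IntegrableOn (fun _ => r⁻¹) A volume := integrableOn_const hA.ne
  calc ∫ y in A, ‖x - y‖⁻¹ ≤ ∫ y in A, (r⁻¹ + g y) :=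
        integral_mono_of_nonneg (.of_forall fun y => by positivity)
          (hAconst.add hgint.integrableOn) (.of_forall hle)
    _ = volume.real A * r⁻¹ + ∫ y in A, g y := by
        rw [integral_add hAconst hgint.integrableOn, setIntegral_const, smul_eq_mul]
    _ ≤ volume.real A * r⁻¹ + Real.pi * r := by
        rw [← hgtot]
        exact add_le_add_right (setIntegral_le_integral hgint hg0) _

theorem stmt14 :
    (∀ A : Set (EuclideanSpace ℝ (Fin 2)), MeasurableSet A → volume A < ⊤ →
      ∀ x : EuclideanSpace ℝ (Fin 2),
        (∫ y in A, ‖x - y‖⁻¹) ≤ 2 * Real.sqrt (Real.pi * (volume A).toReal)) ∧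
    (∀ (x : EuclideanSpace ℝ (Fin 2)) (r : ℝ), 0 < r →
      (∫ y in Metric.ball x r, ‖x - y‖⁻¹)
        = 2 * Real.sqrt (Real.pi * (volume (Metric.ball x r)).toReal)) := by
  have hpi := Real.pi_pos
  refine ⟨fun A _ hA x => ?_, fun x r hr => ?_⟩
  · rcases eq_or_ne (volume A) 0 with h0 | h0
    · simp [Measure.restrict_eq_zero.2 h0, h0]
    have ha : 0 < (volume A).toReal := ENNReal.toReal_pos h0 hA.ne
    set s := Real.sqrt (Real.pi * (volume A).toReal)
    have hs : 0 < s := Real.sqrt_pos.2 (by positivity)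
    have hss : s ^ 2 = Real.pi * (volume A).toReal := Real.sq_sqrt (by positivity)
    refine (setIntegral_inv_norm_sub_le hA x (r := s / Real.pi) (by positivity)).trans_eq ?_
    rw [measureReal_def]
    field_simp
    linarith
  · rw [setIntegral_ball_inv_norm_sub x hr, ← measureReal_def, volume_real_ball_fin_two x hr.le,
      show Real.pi * (Real.pi * r ^ 2) = (Real.pi * r) ^ 2 by ring, Real.sqrt_sq (by positivity)]
    ring
end

section
/- Let ζ : ℝ² → [0,∞] be measurable. Then for every x ∈ ℝ², ∫_{ℝ²} ζ(y) |x − y|^{−1} dy ≤ 2√π ∫₀^∞ |\{y ∈ ℝ² : ζ(y) > s\}|^{1/2} ds, where |·| denotes two-dimensional Lebesgue measure. -/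
open MeasureTheory
open scoped ENNReal

/-- Layer cake formula for `ℝ≥0∞`-valued functions, with a weight. -/
theorem lintegral_mul_eq_lintegral_superlevel {α : Type*} [MeasurableSpace α] (μ : Measure α)
    [SFinite μ] {f g : α → ℝ≥0∞} (hf : Measurable f) (hg : Measurable g) :
    ∫⁻ y, f y * g y ∂μ =
      ∫⁻ s in Set.Ioi (0 : ℝ), ∫⁻ y in {y | ENNReal.ofReal s < f y}, g y ∂μ := by
  have hvol (a : ℝ≥0∞) : volume.restrict (Set.Ioi (0 : ℝ)) {s | ENNReal.ofReal s < a} = a := by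
    rw [Measure.restrict_apply (measurableSet_lt ENNReal.measurable_ofReal measurable_const)]
    induction a with
    | top => simp
    | coe a =>
      have : {s : ℝ | ENNReal.ofReal s < a} ∩ Set.Ioi 0 = Set.Ioo 0 (a : ℝ) := by
        ext s
        simp only [Set.mem_inter_iff, Set.mem_ofPred_eq, Set.mem_Ioi, Set.mem_Ioo]
        rw [and_comm]
        refine and_congr_right fun hs ↦ ?_
        rw [← ENNReal.ofReal_coe_nnreal, ENNReal.ofReal_lt_ofReal_iff_of_nonneg hs.le]
      rw [this, Real.volume_Ioo, sub_zero, ENNReal.ofReal_coe_nnreal]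
  have hmeas : MeasurableSet {p : α × ℝ | ENNReal.ofReal p.2 < f p.1} :=
    measurableSet_lt (ENNReal.measurable_ofReal.comp measurable_snd) (hf.comp measurable_fst)
  calc ∫⁻ y, f y * g y ∂μ
      = ∫⁻ y, (∫⁻ s in Set.Ioi (0 : ℝ),
          {p : α × ℝ | ENNReal.ofReal p.2 < f p.1}.indicator (fun p ↦ g p.1) (y, s)) ∂μ := by
        refine lintegral_congr fun y ↦ ?_
        have : (fun s : ℝ ↦ {p : α × ℝ | ENNReal.ofReal p.2 < f p.1}.indicator
            (fun p ↦ g p.1) (y, s)) = {s | ENNReal.ofReal s < f y}.indicator fun _ ↦ g y := by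
          ext s
          simp [Set.indicator_apply]
        rw [this, lintegral_indicator_const
          (measurableSet_lt ENNReal.measurable_ofReal measurable_const), hvol, mul_comm]
    _ = ∫⁻ s in Set.Ioi (0 : ℝ), ∫⁻ y,
          {p : α × ℝ | ENNReal.ofReal p.2 < f p.1}.indicator (fun p ↦ g p.1) (y, s) ∂μ :=
        lintegral_lintegral_swap (f := fun y s ↦ {p : α × ℝ | ENNReal.ofReal p.2 < f p.1}.indicator
          (fun p ↦ g p.1) (y, s)) ((hg.comp measurable_fst).indicator hmeas).aemeasurable
    _ = _ := by
        refine lintegral_congr fun s ↦ ?_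
        rw [← lintegral_indicator (measurableSet_lt measurable_const hf)]
        rfl

theorem lintegral_Ioi_const_div_sq {c t₀ : ℝ} (hc : 0 ≤ c) (ht₀ : 0 < t₀) :
    ∫⁻ t in Set.Ioi t₀, ENNReal.ofReal (c / t ^ 2) = ENNReal.ofReal (c / t₀) := by
  have hrpow : ∀ t ∈ Set.Ioi t₀, c / t ^ 2 = c * t ^ (-2 : ℝ) := fun t ht ↦ by
    rw [Real.rpow_neg (ht₀.trans ht).le, Real.rpow_two, div_eq_mul_inv]
  have hint : IntegrableOn (fun t : ℝ ↦ c / t ^ 2) (Set.Ioi t₀) :=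
    (integrableOn_congr_fun hrpow measurableSet_Ioi).2
      ((integrableOn_Ioi_rpow_of_lt (by norm_num) ht₀).const_mul c)
  rw [← ofReal_integral_eq_lintegral_ofReal hint (.of_forall fun t ↦ by positivity),
    setIntegral_congr_fun measurableSet_Ioi hrpow, integral_const_mul,
    integral_Ioi_rpow_of_lt (by norm_num) ht₀]
  norm_num [Real.rpow_neg ht₀.le, div_eq_mul_inv]

/-- Among planar sets of given measure, the potential of `1 / |x|` is at most that of a disc. -/
theorem setLIntegral_inv_norm_sub_le (x : EuclideanSpace ℝ (Fin 2))
    (A : Set (EuclideanSpace ℝ (Fin 2))) :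
    ∫⁻ y in A, (ENNReal.ofReal ‖x - y‖)⁻¹ ≤
      ENNReal.ofReal (2 * Real.sqrt Real.pi) * volume A ^ ((1 : ℝ) / 2) := by
  have hpi := Real.pi_pos
  rcases eq_or_ne (volume A) 0 with h0 | h0
  · simp [Measure.restrict_eq_zero.2 h0]
  rcases eq_or_ne (volume A) ∞ with htop | htop
  · rw [htop, ENNReal.top_rpow_of_pos (by norm_num), ENNReal.mul_top]
    · exact le_top
    · simpa using hpi
  obtain ⟨m, hm, hAm⟩ : ∃ m : ℝ, 0 < m ∧ volume A = ENNReal.ofReal m :=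
    ⟨_, ENNReal.toReal_pos h0 htop, (ENNReal.ofReal_toReal htop).symm⟩
  have hlevel {t : ℝ} (ht : 0 < t) :
      {y | ENNReal.ofReal t < (ENNReal.ofReal ‖x - y‖)⁻¹} = Metric.ball x t⁻¹ := by
    ext y
    rw [Set.mem_ofPred_eq, ENNReal.lt_inv_iff_lt_inv, ← ENNReal.ofReal_inv_of_pos ht,
      ENNReal.ofReal_lt_ofReal_iff (inv_pos.2 ht), Metric.mem_ball, dist_comm, dist_eq_norm]
  set t₀ : ℝ := Real.sqrt Real.pi / Real.sqrt m with ht₀_def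
  have ht₀ : 0 < t₀ := by positivity
  have hlayer := lintegral_mul_eq_lintegral_superlevel (volume.restrict A)
    (f := fun y ↦ (ENNReal.ofReal ‖x - y‖)⁻¹) (g := fun _ ↦ 1) (by fun_prop) measurable_const
  simp only [mul_one, lintegral_const, Measure.restrict_apply_univ, one_mul] at hlayer
  rw [hlayer, ← Set.Ioc_union_Ioi_eq_Ioi ht₀.le]
  calc _ ≤ (∫⁻ _ in Set.Ioc 0 t₀, ENNReal.ofReal m) +
        ∫⁻ t in Set.Ioi t₀, ENNReal.ofReal (Real.pi / t ^ 2) := by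
        refine (lintegral_union_le _ _ _).trans (add_le_add ?_ ?_)
        · refine lintegral_mono fun t ↦ ?_
          rw [← hAm]
          exact (measure_mono (Set.subset_univ _)).trans_eq (Measure.restrict_apply_univ A)
        · refine setLIntegral_mono_ae' measurableSet_Ioi (.of_forall fun t ht ↦ ?_)
          have ht' : 0 < t := ht₀.trans ht
          rw [hlevel ht']
          refine (Measure.restrict_apply_le _ _).trans_eq ?_
          rw [EuclideanSpace.volume_ball_fin_two, ← ENNReal.ofReal_pow (by positivity),
            ← ENNReal.ofReal_mul (by positivity)]
          congr 1
          simp [div_eq_mul_inv, mul_comm]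
    _ = ENNReal.ofReal (m * t₀ + Real.pi / t₀) := by
        rw [lintegral_Ioi_const_div_sq hpi.le ht₀, setLIntegral_const, Real.volume_Ioc, sub_zero,
          ← ENNReal.ofReal_mul hm.le, ← ENNReal.ofReal_add (by positivity) (by positivity)]
    _ = _ := by
        rw [hAm, ENNReal.ofReal_rpow_of_pos hm, ← ENNReal.ofReal_mul (by positivity),
          ← Real.sqrt_eq_rpow]
        congr 1
        have h1 := Real.mul_self_sqrt hm.le
        have h2 := Real.mul_self_sqrt hpi.le
        have h3 := Real.sqrt_pos.2 hm
        have h4 := Real.sqrt_pos.2 hpi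
        have e1 : m * t₀ = Real.sqrt Real.pi * Real.sqrt m := by
          rw [ht₀_def]; field_simp; nlinarith
        have e2 : Real.pi / t₀ = Real.sqrt Real.pi * Real.sqrt m := by
          rw [ht₀_def]; field_simp; nlinarith
        rw [e1, e2]
        ring

theorem stmt15 (ζ : EuclideanSpace ℝ (Fin 2) → ℝ≥0∞) (hζ : Measurable ζ)
    (x : EuclideanSpace ℝ (Fin 2)) :
    (∫⁻ y, ζ y * (ENNReal.ofReal ‖x - y‖)⁻¹) ≤
      ENNReal.ofReal (2 * Real.sqrt Real.pi) *
        ∫⁻ s in Set.Ioi (0:ℝ), (volume {y | ENNReal.ofReal s < ζ y}) ^ ((1:ℝ)/2) := by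
  rw [lintegral_mul_eq_lintegral_superlevel volume hζ (by fun_prop),
    ← lintegral_const_mul' _ _ ENNReal.ofReal_ne_top]
  exact lintegral_mono fun s ↦ setLIntegral_inv_norm_sub_le x _
end
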